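/- Let D be a dyadic grid in ℝ^d, let w be a weight with [w]_FW < ∞, let η ∈ (0,1], let S ⊆ D be an η-sparse collection, let Q_0 ∈ S, and define h_{S(Q_0)} := Σ_{Q∈S, Q⊆Q_0} 1_Q. Then there exist δ > 0, depending only on d, and a constant c, depending only on d, such that for all λ > 0: w( { x ∈ Q_0 : h_{S(Q_0)}(x) > λ } ) ≤ c · exp( −ηδλ/[w]_FW ) · w(Q_0). -/

import Mathlib

open MeasureTheory ENNReal Set

noncomputable section

namespace Paper

variable {d m : ℕ}

abbrev Rd (d : ℕ) := Fin d → ℝ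

structure Cube (d : ℕ) where
  corner : Rd d
  side : ℝ
  side_pos : 0 < side

def Cube.set (Q : Cube d) : Set (Rd d) :=
  {x | ∀ i, Q.corner i ≤ x i ∧ x i < Q.corner i + Q.side}

/-- the average `⟨f⟩_{q,Q}` for finite exponent `q`, of an `ℝ≥0∞`-valued function -/
def eAvg (f : Rd d → ℝ≥0∞) (q : ℝ) (Q : Cube d) : ℝ≥0∞ :=
  ((volume Q.set)⁻¹ * ∫⁻ x in Q.set, f x ^ q) ^ (1 / q)

def ofFn (f : Rd d → ℝ) : Rd d → ℝ≥0∞ := fun x => ENNReal.ofReal |f x|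

/-- the average `⟨f⟩_{q,Q}` for finite exponent `q > 0` -/
def avg (f : Rd d → ℝ) (q : ℝ) (Q : Cube d) : ℝ≥0∞ := eAvg (ofFn f) q Q

/-- the average `⟨f⟩_{q,Q}` for exponent `q ∈ (0,∞]` -/
def avgE (f : Rd d → ℝ) (q : ℝ≥0∞) (Q : Cube d) : ℝ≥0∞ :=
  if q = ∞ then essSup (ofFn f) (volume.restrict Q.set) else avg f q.toReal Q

def IsWeight (u : Rd d → ℝ) : Prop :=
  MeasureTheory.LocallyIntegrable u volume ∧ ∀ᵐ x ∂(volume : Measure (Rd d)), 0 < u x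

/-- `u(A) = ∫_A u dx` -/
def wMeas (u : Rd d → ℝ) (A : Set (Rd d)) : ℝ≥0∞ := ∫⁻ x in A, ENNReal.ofReal (u x)

/-- the Hardy–Littlewood maximal operator -/
def maximal (f : Rd d → ℝ) (x : Rd d) : ℝ≥0∞ :=
  ⨆ (Q : Cube d) (_ : x ∈ Q.set), avg f 1 Q

/-- the Fujii–Wilson constant `[u]_FW` -/
def FW (u : Rd d → ℝ) : ℝ≥0∞ :=
  ⨆ Q : Cube d, (wMeas u Q.set)⁻¹ * ∫⁻ x in Q.set, maximal (Q.set.indicator u) x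

/-- Hölder conjugate in `ℝ≥0∞` -/
def conj (q : ℝ≥0∞) : ℝ≥0∞ := (1 - q⁻¹)⁻¹

def prodW (w : Fin m → Rd d → ℝ) : Rd d → ℝ := fun x => ∏ j, w j x

/-- the two-weight multilinear Muckenhoupt constant `[w⃗,ω]_{p⃗}`; here `p0` is the
real number with `1/p0 = ∑ 1/p j`. -/
def APtw (p0 : ℝ) (p : Fin m → ℝ≥0∞) (w : Fin m → Rd d → ℝ) (ω : Rd d → ℝ) : ℝ≥0∞ :=
  ⨆ Q : Cube d, avg ω p0 Q * ∏ j, avgE (fun x => (w j x)⁻¹) (conj (p j)) Q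

/-- the multilinear Muckenhoupt constant `[w⃗]_{p⃗}` -/
def AP (p0 : ℝ) (p : Fin m → ℝ≥0∞) (w : Fin m → Rd d → ℝ) : ℝ≥0∞ :=
  APtw p0 p w (prodW w)

def IsSparse (η : ℝ) (S : Set (Cube d)) : Prop :=
  ∃ E : Cube d → Set (Rd d),
    (∀ Q ∈ S, E Q ⊆ Q.set ∧ MeasurableSet (E Q) ∧
      ENNReal.ofReal η * volume Q.set ≤ volume (E Q)) ∧
    S.PairwiseDisjoint E

def dyadicGrid (d : ℕ) (α : Rd d) : Set (Cube d) :=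
  {Q | ∃ (j : ℤ) (k : Fin d → ℤ),
    Q.side = (2:ℝ) ^ (-j) ∧ ∀ i, Q.corner i = (2:ℝ) ^ (-j) * (α i + k i)}

def IsDyadicGrid (D : Set (Cube d)) : Prop :=
  ∃ α : Rd d, (∀ i, α i = 0 ∨ α i = 1/3 ∨ α i = 2/3) ∧ D = dyadicGrid d α

/-- bounded, compactly supported, measurable -/
def BCS (f : Rd d → ℝ) : Prop :=
  Measurable f ∧ (∃ C, ∀ x, |f x| ≤ C) ∧ HasCompactSupport f

def sparseForm (S : Set (Cube d)) (f : Fin m → Rd d → ℝ) (g : Rd d → ℝ) : ℝ≥0∞ :=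
  ∑' Q : S, (∏ j, avg (f j) 1 Q.1) * avg g 1 Q.1 * volume (Q.1).set

def SparseFormDom (T : (Fin m → Rd d → ℝ) → Rd d → ℝ) (CT : ℝ≥0∞) : Prop :=
  ∀ (f : Fin m → Rd d → ℝ) (g : Rd d → ℝ), (∀ j, BCS (f j)) → BCS g →
    ∃ S : Set (Cube d), IsSparse (1/2) S ∧
      (∫⁻ x, ofFn (T f) x * ofFn g x) ≤ CT * sparseForm S f g

/-- `‖f‖_{L^{p,∞}_u} = sup_{λ>0} λ (u^p({f > λ}))^{1/p}` for `ℝ≥0∞`-valued `f` -/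
def eWeakNorm (u : Rd d → ℝ) (p : ℝ) (f : Rd d → ℝ≥0∞) : ℝ≥0∞ :=
  ⨆ (l : ℝ) (_ : 0 < l), ENNReal.ofReal l *
    (∫⁻ x in {x | ENNReal.ofReal l < f x}, ENNReal.ofReal (u x) ^ p) ^ (1/p)

def weakNorm (u : Rd d → ℝ) (p : ℝ) (f : Rd d → ℝ) : ℝ≥0∞ := eWeakNorm u p (ofFn f)

/-- `‖f‖_{L^p_u} = ‖fu‖_{L^p}` -/
def LpW (u : Rd d → ℝ) (p : ℝ≥0∞) (f : Rd d → ℝ) : ℝ≥0∞ :=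
  eLpNorm (fun x => f x * u x) p volume

section Nested

variable {ι X : Type*}

open Classical in
/-- On a finite chain of sets, `(1 + θ) ^ #C` is controlled by the sum of the same quantity over
the members of the chain. -/
lemma one_add_pow_card_le_of_chain (s : ι → Set X) (r : ι → ℝ) (θ : ℝ≥0∞) (C : Finset ι)
    (hC : ∀ P ∈ C, ∀ Q ∈ C, r Q ≤ r P → s Q ⊆ s P) :
    (1 + θ) ^ C.card ≤ 1 + θ * ∑ Q ∈ C, (1 + θ) ^ (C.filter fun P => s P ⊆ s Q).card := by
  induction C using Finset.induction_on_max_value r with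
  | empty => simp
  | insert P C hP hmax ih =>
    have ih' := ih fun A hA B hB =>
      hC A (Finset.mem_insert_of_mem hA) B (Finset.mem_insert_of_mem hB)
    have hfull : ((insert P C).filter fun A => s A ⊆ s P) = insert P C := by
      refine Finset.filter_true_of_mem fun A hA => hC P (Finset.mem_insert_self _ _) A hA ?_
      rcases Finset.mem_insert.1 hA with rfl | h
      · exact le_rfl
      · exact hmax A h
    have hmono : ∑ Q ∈ C, (1 + θ) ^ (C.filter fun A => s A ⊆ s Q).card ≤
        ∑ Q ∈ C, (1 + θ) ^ ((insert P C).filter fun A => s A ⊆ s Q).card := by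
      gcongr with Q _
      · exact le_self_add
      · exact Finset.subset_insert _ _
    rw [Finset.sum_insert hP, hfull, Finset.card_insert_of_notMem hP]
    calc (1 + θ) ^ (C.card + 1) = (1 + θ) ^ C.card + θ * (1 + θ) ^ C.card := by ring
      _ ≤ (1 + θ * ∑ Q ∈ C, (1 + θ) ^ ((insert P C).filter fun A => s A ⊆ s Q).card)
          + θ * (1 + θ) ^ (C.card + 1) := by
          gcongr
          · exact ih'.trans (by gcongr)
          · exact le_self_add
          · omega
      _ = _ := by ring

open Classical in
/-- The number of members of `F` contained in `s R` that contain `x`. -/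
def height (s : ι → Set X) (F : Finset ι) (R : ι) (x : X) : ℕ :=
  (F.filter fun Q => s Q ⊆ s R ∧ x ∈ s Q).card

lemma height_le_card (s : ι → Set X) (F : Finset ι) (R : ι) (x : X) :
    height s F R x ≤ F.card := by
  classical exact Finset.card_filter_le _ _

lemma measurable_height [MeasurableSpace X] {s : ι → Set X} (hs : ∀ Q, MeasurableSet (s Q))
    (F : Finset ι) (R : ι) : Measurable (height s F R) := by
  classical
  have : height s F R =
      fun x => ∑ Q ∈ F.filter (fun Q => s Q ⊆ s R), (s Q).indicator (fun _ => 1) x := by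
    ext x
    simp only [height, ← Finset.filter_filter, Finset.card_filter, Set.indicator_apply]
  rw [this]
  exact Finset.measurable_sum _ fun Q _ => measurable_const.indicator (hs Q)

/-- A finite family of sets in which `r` witnesses that two members are nested or disjoint. -/
def IsNested (s : ι → Set X) (r : ι → ℝ) (F : Finset ι) : Prop :=
  ∀ P ∈ F, ∀ Q ∈ F, r Q ≤ r P → (s P ∩ s Q).Nonempty → s Q ⊆ s P

open Classical in
lemma one_add_pow_height_le {s : ι → Set X} {r : ι → ℝ} {F : Finset ι} (hF : IsNested s r F)
    (θ : ℝ≥0∞) (R : ι) (x : X) :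
    (1 + θ) ^ height s F R x ≤
      1 + θ * ∑ Q ∈ F.filter (fun Q => s Q ⊆ s R),
        (s Q).indicator (fun y => (1 + θ) ^ height s F Q y) x := by
  refine (one_add_pow_card_le_of_chain s r θ _ ?_).trans ?_
  · simp only [Finset.mem_filter]
    rintro P ⟨hP, -, hxP⟩ Q ⟨hQ, -, hxQ⟩ h
    exact hF P hP Q hQ h ⟨x, hxP, hxQ⟩
  · rw [← Finset.filter_filter, Finset.sum_filter (fun Q => x ∈ s Q)]
    gcongr with Q _
    rw [Set.indicator_apply]
    split_ifs
    · refine pow_le_pow_right₀ le_self_add (Finset.card_le_card fun P => ?_)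
      simp only [Finset.mem_filter]
      tauto
    · exact le_rfl

open Classical in
/-- Exponential integrability of the height function of a finite nested Carleson family. -/
lemma lintegral_one_add_pow_height_le [MeasurableSpace X] {μ : Measure X} {s : ι → Set X}
    (hs : ∀ Q, MeasurableSet (s Q)) (hpos : ∀ Q, μ (s Q) ≠ 0) (hfin : ∀ Q, μ (s Q) ≠ ∞)
    {r : ι → ℝ} {F : Finset ι} (hF : IsNested s r F) {θ Λ : ℝ≥0∞} (hθ : θ ≠ ∞)
    (hθΛ : θ * Λ ≤ 2⁻¹)
    (hΛ : ∀ R, ∑ Q ∈ F.filter (fun Q => s Q ⊆ s R), μ (s Q) ≤ Λ * μ (s R)) (R : ι) :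
    ∫⁻ x in s R, (1 + θ) ^ height s F R x ∂μ ≤ 2 * μ (s R) := by
  set I : ι → ℝ≥0∞ := fun R => ∫⁻ x in s R, (1 + θ) ^ height s F R x ∂μ
  have hmeas : ∀ Q, Measurable fun x => (1 + θ) ^ height s F Q x := fun Q =>
    (Measurable.of_discrete (f := fun n : ℕ => (1 + θ) ^ n)).comp (measurable_height hs F Q)
  have hrec : ∀ R, I R ≤ μ (s R) + θ * ∑ Q ∈ F.filter (fun Q => s Q ⊆ s R), I Q := by
    intro R
    calc I R ≤ ∫⁻ x in s R, (1 + θ * ∑ Q ∈ F.filter (fun Q => s Q ⊆ s R),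
          (s Q).indicator (fun y => (1 + θ) ^ height s F Q y) x) ∂μ :=
          lintegral_mono fun x => one_add_pow_height_le hF θ R x
      _ = μ (s R) + θ * ∑ Q ∈ F.filter (fun Q => s Q ⊆ s R),
          ∫⁻ x in s R, (s Q).indicator (fun y => (1 + θ) ^ height s F Q y) x ∂μ := by
          rw [lintegral_add_left measurable_const, lintegral_const_mul' _ _ hθ,
            lintegral_finsetSum _ fun Q _ => (hmeas Q).indicator (hs Q)]
          simp
      _ ≤ _ := by
          gcongr with Q _
          refine le_trans ?_ (lintegral_indicator (hs Q) _).le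
          exact setLIntegral_le_lintegral _ _
  obtain ⟨B, hBdef⟩ : ∃ B : ℝ≥0∞, B = ⨆ R, I R / μ (s R) := ⟨_, rfl⟩
  have hIB : ∀ R, I R ≤ B * μ (s R) := fun R =>
    (ENNReal.div_le_iff (hpos R) (hfin R)).1 (hBdef ▸ le_iSup (fun R => I R / μ (s R)) R)
  have hBtop : B ≠ ∞ := by
    rw [hBdef]
    refine ne_top_of_le_ne_top (ENNReal.pow_ne_top (n := F.card)
      (ENNReal.add_ne_top.2 ⟨one_ne_top, hθ⟩)) (iSup_le fun R => ?_)
    rw [ENNReal.div_le_iff (hpos R) (hfin R), ← setLIntegral_const]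
    exact lintegral_mono fun x => pow_le_pow_right₀ le_self_add (height_le_card s F R x)
  have hB : B ≤ 1 + 2⁻¹ * B := by
    nth_rewrite 1 [hBdef]
    refine iSup_le fun R => ?_
    rw [ENNReal.div_le_iff (hpos R) (hfin R)]
    calc I R ≤ μ (s R) + θ * ∑ Q ∈ F.filter (fun Q => s Q ⊆ s R), B * μ (s Q) :=
          (hrec R).trans (by gcongr with Q _; exact hIB Q)
      _ = μ (s R) + θ * B * ∑ Q ∈ F.filter (fun Q => s Q ⊆ s R), μ (s Q) := by
          rw [← Finset.mul_sum, mul_assoc]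
      _ ≤ μ (s R) + θ * B * (Λ * μ (s R)) := by gcongr; exact hΛ R
      _ = (1 + (θ * Λ) * B) * μ (s R) := by ring
      _ ≤ _ := by gcongr
  have hB2 : B ≤ 2 := by
    clear hBdef hIB
    lift B to NNReal using hBtop
    have h : ((2 : ℝ≥0∞)⁻¹) = ((2⁻¹ : NNReal) : ℝ≥0∞) := by simp
    rw [h] at hB
    norm_cast at hB ⊢
    rw [← NNReal.coe_le_coe] at hB ⊢
    push_cast at hB ⊢
    linarith
  exact (hIB R).trans (by gcongr)

lemma exp_half_le_one_add {t : ℝ} (h0 : 0 ≤ t) (h1 : t ≤ 1) : Real.exp (t / 2) ≤ 1 + t := by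
  have h := Real.add_one_le_exp (-(t / 2))
  have hmul : Real.exp (t / 2) * Real.exp (-(t / 2)) = 1 := by
    rw [← Real.exp_add]; simp
  nlinarith [Real.exp_pos (t / 2), Real.exp_pos (-(t / 2))]

open Classical in
/-- Exponential decay of the height function of a finite nested Carleson family. -/
lemma measure_lt_height_le [MeasurableSpace X] {μ : Measure X} {s : ι → Set X}
    (hs : ∀ Q, MeasurableSet (s Q)) (hpos : ∀ Q, μ (s Q) ≠ 0) (hfin : ∀ Q, μ (s Q) ≠ ∞)
    {r : ι → ℝ} {F : Finset ι} (hF : IsNested s r F) {Λ : ℝ} (hΛ1 : 1 ≤ Λ)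
    (hΛ : ∀ R, ∑ Q ∈ F.filter (fun Q => s Q ⊆ s R), μ (s Q) ≤ ENNReal.ofReal Λ * μ (s R))
    (R : ι) (lam : ℝ) :
    μ {x | x ∈ s R ∧ lam < height s F R x} ≤
      ENNReal.ofReal (2 * Real.exp (-(lam / (4 * Λ)))) * μ (s R) := by
  have hΛ0 : 0 < Λ := by linarith
  set t : ℝ := 1 / (2 * Λ) with ht
  have ht0 : 0 ≤ t := by positivity
  have ht1 : t ≤ 1 := by rw [ht, div_le_one (by positivity)]; linarith
  have hint := lintegral_one_add_pow_height_le hs hpos hfin hF (θ := ENNReal.ofReal t)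
    ofReal_ne_top (by
      rw [← ENNReal.ofReal_mul ht0, ← ENNReal.ofReal_ofNat 2, ← ENNReal.ofReal_inv_of_pos two_pos]
      apply ENNReal.ofReal_le_ofReal
      rw [ht]; apply le_of_eq; field_simp) hΛ R
  have hsub : {x | x ∈ s R ∧ lam < height s F R x} ⊆
      {x | ENNReal.ofReal (Real.exp (lam / (4 * Λ))) ≤
        (1 + ENNReal.ofReal t) ^ height s F R x} ∩ s R := by
    rintro x ⟨hx, hlt⟩
    refine ⟨?_, hx⟩
    rw [mem_ofPred_eq, ← ENNReal.ofReal_one, ← ENNReal.ofReal_add zero_le_one ht0,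
      ← ENNReal.ofReal_pow (by positivity)]
    apply ENNReal.ofReal_le_ofReal
    calc Real.exp (lam / (4 * Λ)) ≤ Real.exp (height s F R x * (t / 2)) := by
          rw [Real.exp_le_exp, ht]
          have : (height s F R x : ℝ) * (1 / (2 * Λ) / 2) = height s F R x / (4 * Λ) := by
            field_simp; norm_num
          rw [this]
          gcongr
      _ = Real.exp (t / 2) ^ height s F R x := by rw [Real.exp_nat_mul]
      _ ≤ _ := by gcongr; exact exp_half_le_one_add ht0 ht1
  have hcheb := mul_meas_ge_le_lintegral₀ (μ := μ.restrict (s R))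
    (f := fun x => (1 + ENNReal.ofReal t) ^ height s F R x)
    ((Measurable.of_discrete (f := fun n : ℕ => (1 + ENNReal.ofReal t) ^ n)).comp
      (measurable_height hs F R)).aemeasurable (ENNReal.ofReal (Real.exp (lam / (4 * Λ))))
  rw [Measure.restrict_apply' (hs R)] at hcheb
  have hmain := (mul_le_mul_right (measure_mono (μ := μ) hsub)
    (ENNReal.ofReal (Real.exp (lam / (4 * Λ))))).trans (hcheb.trans hint)
  calc μ {x | x ∈ s R ∧ lam < height s F R x}
      = ENNReal.ofReal (Real.exp (-(lam / (4 * Λ)))) * (ENNReal.ofReal (Real.exp (lam / (4 * Λ)))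
          * μ {x | x ∈ s R ∧ lam < height s F R x}) := by
        rw [← mul_assoc, ← ENNReal.ofReal_mul (Real.exp_pos _).le, ← Real.exp_add]
        simp
    _ ≤ ENNReal.ofReal (Real.exp (-(lam / (4 * Λ)))) * (2 * μ (s R)) := by gcongr
    _ = _ := by
        rw [ENNReal.ofReal_mul two_pos.le, ENNReal.ofReal_ofNat]; ring

end Nested

lemma Cube.set_eq_pi (Q : Cube d) :
    Q.set = Set.pi univ fun i => Ico (Q.corner i) (Q.corner i + Q.side) := by
  ext x; simp [Cube.set]

lemma Cube.measurableSet (Q : Cube d) : MeasurableSet Q.set := by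
  rw [Q.set_eq_pi]
  exact MeasurableSet.univ_pi fun i => measurableSet_Ico

lemma Cube.volume_ne_zero (Q : Cube d) : volume Q.set ≠ 0 := by
  simp [Q.set_eq_pi, volume_pi_pi, Q.side_pos]

lemma Cube.volume_ne_top (Q : Cube d) : volume Q.set ≠ ∞ := by
  simp [Q.set_eq_pi, volume_pi_pi]

lemma IsWeight.wMeas_ne_zero {w : Rd d → ℝ} (hw : IsWeight w) (Q : Cube d) :
    wMeas w Q.set ≠ 0 := by
  intro h
  have hm : AEMeasurable (fun x => ENNReal.ofReal (w x)) (volume.restrict Q.set) :=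
    hw.1.aestronglyMeasurable.aemeasurable.ennreal_ofReal.restrict
  have h0 := (lintegral_eq_zero_iff' hm).1 h
  have : ∀ᵐ x ∂(volume.restrict Q.set), False := by
    filter_upwards [h0, ae_restrict_of_ae hw.2] with x hx hx'
    simp only [Pi.zero_apply, ENNReal.ofReal_eq_zero] at hx
    linarith
  rw [Filter.eventually_false_iff_eq_bot, ae_eq_bot, Measure.restrict_eq_zero] at this
  exact Q.volume_ne_zero this

lemma IsWeight.wMeas_ne_top {w : Rd d → ℝ} (hw : IsWeight w) (Q : Cube d) :
    wMeas w Q.set ≠ ∞ := by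
  have hsub : Q.set ⊆ Icc Q.corner (fun i => Q.corner i + Q.side) := fun x hx =>
    ⟨fun i => (hx i).1, fun i => (hx i).2.le⟩
  have hint : IntegrableOn w Q.set := (hw.1.integrableOn_isCompact isCompact_Icc).mono_set hsub
  refine ne_top_of_le_ne_top hint.2.ne (lintegral_mono fun x => ?_)
  exact Real.ofReal_le_enorm _

lemma IsWeight.wMeas_eq_volume_mul_avg {w : Rd d → ℝ} (hw : IsWeight w) {Q R : Cube d}
    (hQR : Q.set ⊆ R.set) :
    wMeas w Q.set = volume Q.set * avg (R.set.indicator w) 1 Q := by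
  have : ∫⁻ x in Q.set, ofFn (R.set.indicator w) x = wMeas w Q.set := by
    refine lintegral_congr_ae ?_
    filter_upwards [ae_restrict_of_ae hw.2, ae_restrict_mem Q.measurableSet] with x hx hxQ
    simp [ofFn, hQR hxQ, abs_of_pos hx]
  simp only [avg, eAvg, ENNReal.rpow_one, div_one]
  rw [this, ← mul_assoc, ENNReal.mul_inv_cancel Q.volume_ne_zero Q.volume_ne_top, one_mul]

lemma IsWeight.lintegral_maximal_le {w : Rd d → ℝ} (hw : IsWeight w) (R : Cube d) :
    ∫⁻ x in R.set, maximal (R.set.indicator w) x ≤ FW w * wMeas w R.set := by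
  have h : (wMeas w R.set)⁻¹ * ∫⁻ x in R.set, maximal (R.set.indicator w) x ≤ FW w :=
    le_iSup (fun Q : Cube d =>
      (wMeas w Q.set)⁻¹ * ∫⁻ x in Q.set, maximal (Q.set.indicator w) x) R
  rwa [mul_comm, ← div_eq_mul_inv,
    ENNReal.div_le_iff (hw.wMeas_ne_zero R) (hw.wMeas_ne_top R)] at h

/-- A sparse family is a Carleson family with respect to a Fujii–Wilson weight. -/
lemma IsSparse.sum_wMeas_le {η : ℝ} (hη : 0 < η) {S : Set (Cube d)} (hS : IsSparse η S)
    {w : Rd d → ℝ} (hw : IsWeight w) (hFW : FW w ≠ ∞) {F : Finset (Cube d)} {R : Cube d}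
    (hFS : ∀ Q ∈ F, Q ∈ S) (hFR : ∀ Q ∈ F, Q.set ⊆ R.set) :
    ∑ Q ∈ F, wMeas w Q.set ≤ ENNReal.ofReal ((FW w).toReal / η) * wMeas w R.set := by
  obtain ⟨E, hE, hdisj⟩ := hS
  have hη0 : ENNReal.ofReal η ≠ 0 := by simpa using hη
  have key : ENNReal.ofReal η * ∑ Q ∈ F, wMeas w Q.set ≤ FW w * wMeas w R.set := by
    calc ENNReal.ofReal η * ∑ Q ∈ F, wMeas w Q.set
        = ∑ Q ∈ F, (ENNReal.ofReal η * volume Q.set) * avg (R.set.indicator w) 1 Q := by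
          rw [Finset.mul_sum]
          refine Finset.sum_congr rfl fun Q hQ => ?_
          rw [hw.wMeas_eq_volume_mul_avg (hFR Q hQ), mul_assoc]
      _ ≤ ∑ Q ∈ F, ∫⁻ x in E Q, maximal (R.set.indicator w) x := by
          refine Finset.sum_le_sum fun Q hQ => ?_
          obtain ⟨hEQ, hEm, hEv⟩ := hE Q (hFS Q hQ)
          calc _ ≤ volume (E Q) * avg (R.set.indicator w) 1 Q := by gcongr
            _ = ∫⁻ _ in E Q, avg (R.set.indicator w) 1 Q := by
              rw [setLIntegral_const, mul_comm]
            _ ≤ _ := setLIntegral_mono' hEm fun x hx =>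
              le_iSup₂ (f := fun (P : Cube d) (_ : x ∈ P.set) => avg (R.set.indicator w) 1 P)
                Q (hEQ hx)
      _ = ∫⁻ x in ⋃ Q ∈ F, E Q, maximal (R.set.indicator w) x :=
          (lintegral_biUnion_finset (hdisj.subset hFS)
            (fun Q hQ => (hE Q (hFS Q hQ)).2.1) _).symm
      _ ≤ ∫⁻ x in R.set, maximal (R.set.indicator w) x :=
          lintegral_mono_set (iUnion₂_subset fun Q hQ =>
            (hE Q (hFS Q hQ)).1.trans (hFR Q hQ))
      _ ≤ _ := hw.lintegral_maximal_le R
  rw [ENNReal.ofReal_div_of_pos hη, ENNReal.ofReal_toReal hFW, ENNReal.mul_comm_div,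
    ← mul_div_assoc, ENNReal.le_div_iff_mul_le (.inl hη0) (.inl ofReal_ne_top), mul_comm]
  exact key

lemma IsSparse.one_le_FW_div {η : ℝ} (hη : 0 < η) {S : Set (Cube d)} (hS : IsSparse η S)
    {w : Rd d → ℝ} (hw : IsWeight w) (hFW : FW w ≠ ∞) {Q : Cube d} (hQ : Q ∈ S) :
    1 ≤ (FW w).toReal / η := by
  have h := hS.sum_wMeas_le hη hw hFW (F := {Q}) (R := Q) (by simpa) (by simp)
  rw [Finset.sum_singleton] at h
  by_contra! hlt
  have h1 : ENNReal.ofReal ((FW w).toReal / η) < 1 := by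
    rwa [← ENNReal.ofReal_one, ENNReal.ofReal_lt_ofReal_iff one_pos]
  have := ENNReal.mul_lt_mul_left (hw.wMeas_ne_zero Q) (hw.wMeas_ne_top Q) h1
  rw [one_mul] at this
  exact absurd h this.not_ge

lemma countable_dyadicGrid (α : Rd d) : (dyadicGrid d α).Countable := by
  refine (countable_range fun p : ℤ × (Fin d → ℤ) =>
    (⟨fun i => (2 : ℝ) ^ (-p.1) * (α i + p.2 i), (2 : ℝ) ^ (-p.1), by positivity⟩ : Cube d)).mono ?_
  rintro ⟨c, r, hr⟩ ⟨j, k, hs, hc⟩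
  refine ⟨(j, k), ?_⟩
  simp only [Cube.mk.injEq]
  exact ⟨funext fun i => (hc i).symm, hs.symm⟩

/-- `Q` has side length an even power of two. -/
def Cube.EvenLevel (Q : Cube d) : Prop := ∃ j : ℤ, Even j ∧ Q.side = (2 : ℝ) ^ (-j)

lemma exists_four_pow_mul_eq_add_int {a : ℝ} (ha : a = 0 ∨ a = 1 / 3 ∨ a = 2 / 3) (n : ℕ) :
    ∃ m : ℤ, (4 : ℝ) ^ n * a = a + m := by
  induction n with
  | zero => exact ⟨0, by simp⟩
  | succ n ih =>
    obtain ⟨m, hm⟩ := ih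
    obtain ⟨b, hb⟩ : ∃ b : ℤ, 3 * a = b := by
      rcases ha with rfl | rfl | rfl
      · exact ⟨0, by norm_num⟩
      · exact ⟨1, by norm_num⟩
      · exact ⟨2, by norm_num⟩
    refine ⟨4 * m + b, ?_⟩
    push_cast
    rw [pow_succ]
    linarith

lemma subset_of_mem_dyadicGrid {α : Rd d} (hα : ∀ i, α i = 0 ∨ α i = 1 / 3 ∨ α i = 2 / 3)
    {P Q : Cube d} {j : ℤ} {n : ℕ} {k l : Fin d → ℤ}
    (hPs : P.side = (2 : ℝ) ^ (-j)) (hPc : ∀ i, P.corner i = (2 : ℝ) ^ (-j) * (α i + k i))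
    (hQs : Q.side = (2 : ℝ) ^ (-(j + 2 * n)))
    (hQc : ∀ i, Q.corner i = (2 : ℝ) ^ (-(j + 2 * n)) * (α i + l i))
    (hne : (P.set ∩ Q.set).Nonempty) : Q.set ⊆ P.set := by
  obtain ⟨x, hxP, hxQ⟩ := hne
  set t : ℝ := (2 : ℝ) ^ (-(j + 2 * n)) with ht
  have ht0 : 0 < t := by positivity
  have hj : (2 : ℝ) ^ (-j) = t * 4 ^ n := by
    have h4 : (4 : ℝ) ^ n = (2 : ℝ) ^ (2 * n : ℤ) := by
      rw [zpow_mul, zpow_natCast]; norm_num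
    rw [h4, ht, ← zpow_add₀ two_ne_zero]
    congr 1; ring
  intro y hy i
  obtain ⟨m, hm⟩ := exists_four_pow_mul_eq_add_int (hα i) n
  have hP := hxP i
  have hQ := hxQ i
  have hyi := hy i
  have hcorner : P.corner i = t * (α i + ((m + 4 ^ n * k i : ℤ) : ℝ)) := by
    rw [hPc, hj]; push_cast; linear_combination t * hm
  have hside : P.side = t * ((4 ^ n : ℤ) : ℝ) := by rw [hPs, hj]; push_cast; ring
  rw [hcorner, hside] at hP ⊢
  rw [hQc, hQs] at hQ hyi
  generalize m + 4 ^ n * k i = a at *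
  generalize (4 ^ n : ℤ) = b at *
  have h1 : a < l i + 1 := by
    have : t * (a : ℝ) < t * (l i + 1) := by linarith
    exact_mod_cast lt_of_mul_lt_mul_left this ht0.le
  have h2 : l i < a + b := by
    have : t * (l i : ℝ) < t * (a + b) := by linarith
    exact_mod_cast lt_of_mul_lt_mul_left this ht0.le
  have h1' : t * (a : ℝ) ≤ t * l i :=
    mul_le_mul_of_nonneg_left (by exact_mod_cast Int.lt_add_one_iff.1 h1) ht0.le
  have h2' : t * ((l i : ℝ) + 1) ≤ t * (a + b) :=
    mul_le_mul_of_nonneg_left (by exact_mod_cast Int.add_one_le_iff.2 h2) ht0.le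
  constructor <;> linarith

lemma Cube.evenLevel_iff {Q : Cube d} {j : ℤ} (h : Q.side = (2 : ℝ) ^ (-j)) :
    Q.EvenLevel ↔ Even j := by
  refine ⟨?_, fun hj => ⟨j, hj, h⟩⟩
  rintro ⟨i, hi, hs⟩
  have : -i = -j := zpow_right_injective₀ (a := (2 : ℝ)) two_pos (by norm_num) (hs.symm.trans h)
  rwa [← neg_inj.1 this]

/-- The cubes of a (shifted) dyadic grid whose levels have the same parity form a nested family. -/
lemma isNested_of_subset_dyadicGrid {α : Rd d}
    (hα : ∀ i, α i = 0 ∨ α i = 1 / 3 ∨ α i = 2 / 3) {F : Finset (Cube d)}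
    (hF : ∀ Q ∈ F, Q ∈ dyadicGrid d α)
    (hpar : ∀ P ∈ F, ∀ Q ∈ F, P.EvenLevel ↔ Q.EvenLevel) :
    IsNested Cube.set Cube.side F := by
  intro P hP Q hQ hle hne
  obtain ⟨j, k, hPs, hPc⟩ := hF P hP
  obtain ⟨j', l, hQs, hQc⟩ := hF Q hQ
  have hjj : j ≤ j' := by
    rw [hPs, hQs, zpow_le_zpow_iff_right₀ _root_.one_lt_two] at hle
    omega
  have hev : Even j ↔ Even j' := by
    rw [← Cube.evenLevel_iff hPs, ← Cube.evenLevel_iff hQs]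
    exact hpar P hP Q hQ
  obtain ⟨n, rfl⟩ : ∃ n : ℕ, j' = j + 2 * n := by
    refine ⟨((j' - j) / 2).toNat, ?_⟩
    rw [Int.even_iff, Int.even_iff] at hev
    omega
  exact subset_of_mem_dyadicGrid hα hPs hPc hQs hQc hne

lemma wMeas_eq_withDensity (w : Rd d → ℝ) (A : Set (Rd d)) :
    wMeas w A = volume.withDensity (fun x => ENNReal.ofReal (w x)) A :=
  (withDensity_apply' _ _).symm

/-- Exponential decay of the height function of a finite sparse family of dyadic cubes. -/
lemma IsSparse.wMeas_lt_height_le {α : Rd d} (hα : ∀ i, α i = 0 ∨ α i = 1 / 3 ∨ α i = 2 / 3)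
    {w : Rd d → ℝ} (hw : IsWeight w) (hFW : FW w ≠ ∞) {η : ℝ} (hη : 0 < η)
    {S : Set (Cube d)} (hSD : S ⊆ dyadicGrid d α) (hS : IsSparse η S) {F : Finset (Cube d)}
    (hF : ∀ Q ∈ F, Q ∈ S) {Q0 : Cube d} (hQ0 : Q0 ∈ S) (lam : ℝ) :
    wMeas w {x | x ∈ Q0.set ∧ lam < height Cube.set F Q0 x} ≤
      ENNReal.ofReal (4 * Real.exp (-(η * (1 / 8) * lam) / (FW w).toReal)) * wMeas w Q0.set := by
  classical
  have hΛ1 := hS.one_le_FW_div hη hw hFW hQ0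
  have half : ∀ G ⊆ F, (∀ P ∈ G, ∀ Q ∈ G, P.EvenLevel ↔ Q.EvenLevel) →
      wMeas w {x | x ∈ Q0.set ∧ lam / 2 < height Cube.set G Q0 x} ≤
      ENNReal.ofReal (2 * Real.exp (-(η * (1 / 8) * lam) / (FW w).toReal)) * wMeas w Q0.set := by
    intro G hG hpar
    have h := measure_lt_height_le (μ := volume.withDensity fun x => ENNReal.ofReal (w x))
      Cube.measurableSet (fun Q => wMeas_eq_withDensity w _ ▸ hw.wMeas_ne_zero Q)
      (fun Q => wMeas_eq_withDensity w _ ▸ hw.wMeas_ne_top Q)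
      (isNested_of_subset_dyadicGrid hα (fun Q hQ => hSD (hF Q (hG hQ))) hpar) hΛ1
      (fun R => by
        simp only [← wMeas_eq_withDensity]
        exact hS.sum_wMeas_le hη hw hFW (fun Q hQ => hF Q (hG (Finset.mem_filter.1 hQ).1))
          fun Q hQ => (Finset.mem_filter.1 hQ).2) Q0 (lam / 2)
    simp only [← wMeas_eq_withDensity] at h
    have he : -(lam / 2 / (4 * ((FW w).toReal / η))) = -(η * (1 / 8) * lam) / (FW w).toReal := by
      have : (FW w).toReal ≠ 0 := by
        intro h0
        rw [h0, zero_div] at hΛ1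
        linarith
      field_simp; ring
    rwa [he] at h
  have hsub : {x | x ∈ Q0.set ∧ lam < height Cube.set F Q0 x} ⊆
      {x | x ∈ Q0.set ∧ lam / 2 < height Cube.set (F.filter Cube.EvenLevel) Q0 x} ∪
      {x | x ∈ Q0.set ∧ lam / 2 < height Cube.set (F.filter fun Q => ¬ Q.EvenLevel) Q0 x} := by
    rintro x ⟨hx, hlt⟩
    have hsplit : height Cube.set F Q0 x = height Cube.set (F.filter Cube.EvenLevel) Q0 x +
        height Cube.set (F.filter fun Q => ¬ Q.EvenLevel) Q0 x := by
      simp only [height, Finset.filter_comm (p := Cube.EvenLevel),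
        Finset.filter_comm (p := fun Q : Cube d => ¬ Q.EvenLevel)]
      exact (Finset.card_filter_add_card_filter_not _).symm
    rw [hsplit] at hlt
    push_cast at hlt
    by_contra hcon
    simp only [mem_union, mem_ofPred_eq, hx, true_and, not_or, not_lt] at hcon
    linarith
  simp only [wMeas_eq_withDensity] at half ⊢
  refine (measure_mono hsub).trans ((measure_union_le _ _).trans
    ((add_le_add (half _ (Finset.filter_subset _ _) ?_)
      (half _ (Finset.filter_subset _ _) ?_)).trans_eq ?_))
  · intro P hP Q hQ
    simp only [Finset.mem_filter] at hP hQ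
    tauto
  · intro P hP Q hQ
    simp only [Finset.mem_filter] at hP hQ
    tauto
  · rw [← add_mul, ← ENNReal.ofReal_add (by positivity) (by positivity)]
    ring_nf

/-- Weighted John–Nirenberg inequality for the height function of a sparse collection. -/
theorem stmt11 (d : ℕ) (hd : 1 ≤ d) :
    ∃ δ c : ℝ, 0 < δ ∧ 0 < c ∧
      ∀ D : Set (Cube d), IsDyadicGrid D →
      ∀ w : Rd d → ℝ, IsWeight w → FW w ≠ ∞ →
      ∀ η : ℝ, 0 < η → η ≤ 1 →
      ∀ S : Set (Cube d), S ⊆ D → IsSparse η S →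
      ∀ Q0 ∈ S, ∀ lam : ℝ, 0 < lam →
        wMeas w {x | x ∈ Q0.set ∧ ENNReal.ofReal lam <
            ∑' Q : {Q ∈ S | Cube.set Q ⊆ Q0.set},
              (Q.1).set.indicator (fun _ => (1 : ℝ≥0∞)) x} ≤
          ENNReal.ofReal (c * Real.exp (-(η * δ * lam) / (FW w).toReal)) *
            wMeas w Q0.set := by
  classical
  refine ⟨1 / 8, 4, by norm_num, by norm_num, ?_⟩
  rintro D ⟨α, hα, rfl⟩ w hw hFW η hη - S hSD hS Q0 hQ0 lam -
  set T : Set (Cube d) := {Q ∈ S | Q.set ⊆ Q0.set}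
  have hTc : Countable T :=
    ((countable_dyadicGrid α).mono ((sep_subset _ _).trans hSD)).to_subtype
  let A : Finset T → Set (Rd d) := fun F =>
    {x | x ∈ Q0.set ∧ lam < height Cube.set (F.map (Function.Embedding.subtype _)) Q0 x}
  have hAmono : Monotone A := by
    rintro F G hFG x ⟨hx, hlt⟩
    refine ⟨hx, hlt.trans_le (Nat.cast_le.2 (Finset.card_le_card ?_))⟩
    exact Finset.filter_subset_filter _ (Finset.map_subset_map.2 hFG)
  have hsub : {x | x ∈ Q0.set ∧ ENNReal.ofReal lam <
      ∑' Q : T, (Q.1).set.indicator (fun _ => (1 : ℝ≥0∞)) x} ⊆ ⋃ F, A F := by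
    rintro x ⟨hx, hlt⟩
    rw [ENNReal.tsum_eq_iSup_sum] at hlt
    obtain ⟨F, hF⟩ := lt_iSup_iff.1 hlt
    refine mem_iUnion.2 ⟨F, hx, ?_⟩
    have hsum : ∑ Q ∈ F, (Q.1).set.indicator (fun _ => (1 : ℝ≥0∞)) x =
        height Cube.set (F.map (Function.Embedding.subtype _)) Q0 x := by
      have hfil : height Cube.set (F.map (Function.Embedding.subtype _)) Q0 x =
          ((F.map (Function.Embedding.subtype _)).filter fun Q => x ∈ Q.set).card := by
        refine congrArg Finset.card (Finset.ext fun Q => ?_)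
        simp only [Finset.mem_filter]
        refine and_congr_right fun hQ => ?_
        obtain ⟨P, -, rfl⟩ := Finset.mem_map.1 hQ
        exact and_iff_right P.2.2
      rw [hfil, Finset.card_filter, Finset.sum_map, Nat.cast_sum]
      refine Finset.sum_congr rfl fun Q _ => ?_
      rw [Set.indicator_apply, Nat.cast_ite, Nat.cast_one, Nat.cast_zero]
      rfl
    rw [hsum, ← ENNReal.ofReal_natCast] at hF
    exact (ENNReal.ofReal_lt_ofReal_iff'.1 hF).1
  rw [wMeas_eq_withDensity]
  refine (measure_mono hsub).trans ?_
  rw [hAmono.directed_le.measure_iUnion]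
  refine iSup_le fun F => ?_
  rw [← wMeas_eq_withDensity]
  refine hS.wMeas_lt_height_le hα hw hFW hη hSD (fun Q hQ => ?_) hQ0 lam
  obtain ⟨P, -, rfl⟩ := Finset.mem_map.1 hQ
  exact P.2.1

end Paper
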